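/- Let (G, d) be a group with a two-sided invariant metric and let A ≤ G be a closed subgroup. Let G * ⟨t⟩ be the free product of G with an infinite cyclic group generated by t, equipped with the Graev metric d*: the maximal two-sided invariant metric satisfying d*(g, h) = d(g, h) for g, h ∈ G, d*(tᵐ, tⁿ) = |m − n| for m, n ∈ ℤ, and d*(g, tᵏ) = d(g, 1) + |k| for g ∈ G, k ∈ ℤ. Let A' be a copy of the group A carrying the metric d restricted to A, let G * A' be the (abstract) free product with its Graev metric D (the maximal two-sided invariant metric with D(g, h) = d(g, h) and D(a, a') = d(a, a') on the factors and D(g, a) = d(g, 1) + d(a, 1) for g ∈ G, a ∈ A'), and let ψ : G * A' → G * ⟨t⟩ be the unique homomorphism with ψ(g) = g for g in the first factor and ψ(a) = t·a·t⁻¹ for a in the second factor (ψ is injective). Then ψ is an isometry onto its image, i.e. D(x, y) = d*(ψ(x), ψ(y)) for all x, y ∈ G * A', if and only if diam(A) = sup_{a, a' ∈ A} d(a, a') ≤ 1. -/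

import Mathlib

/-- A two-sided invariant metric on a group. -/
def IsTSIMetric {G : Type*} [Group G] (d : G → G → ℝ) : Prop :=
  (∀ x y : G, d x y = 0 ↔ x = y) ∧
  (∀ x y : G, d x y = d y x) ∧
  (∀ x y z : G, d x z ≤ d x y + d y z) ∧
  (∀ g x y : G, d (g * x) (g * y) = d x y) ∧
  (∀ g x y : G, d (x * g) (y * g) = d x y)

/-- A set is closed with respect to the metric `d`. -/
def IsDClosed {G : Type*} (d : G → G → ℝ) (S : Set G) : Prop :=
  ∀ x : G, (∀ ε : ℝ, 0 < ε → ∃ s ∈ S, d x s < ε) → x ∈ S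

/-- The Graev metric on the free product `G ∗ ⟨t⟩` of a tsi group with the integers: the maximal
two-sided invariant metric extending `d` on `G`, `|m − n|` on powers of `t`, and assigning
`d(g,1) + |k|` to mixed pairs. -/
def IsGraevMetricFreeProdZ {G : Type*} [Group G] (d : G → G → ℝ)
    (ds : Monoid.Coprod G (Multiplicative ℤ) → Monoid.Coprod G (Multiplicative ℤ) → ℝ) : Prop :=
  IsTSIMetric ds ∧
  (∀ g h : G, ds (Monoid.Coprod.inl g) (Monoid.Coprod.inl h) = d g h) ∧
  (∀ m n : ℤ, ds (Monoid.Coprod.inr (Multiplicative.ofAdd m))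
      (Monoid.Coprod.inr (Multiplicative.ofAdd n)) = |(m : ℝ) - (n : ℝ)|) ∧
  (∀ (g : G) (k : ℤ), ds (Monoid.Coprod.inl g) (Monoid.Coprod.inr (Multiplicative.ofAdd k))
      = d g 1 + |(k : ℝ)|) ∧
  (∀ δ : Monoid.Coprod G (Multiplicative ℤ) → Monoid.Coprod G (Multiplicative ℤ) → ℝ,
    IsTSIMetric δ →
    (∀ g h : G, δ (Monoid.Coprod.inl g) (Monoid.Coprod.inl h) = d g h) →
    (∀ m n : ℤ, δ (Monoid.Coprod.inr (Multiplicative.ofAdd m))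
      (Monoid.Coprod.inr (Multiplicative.ofAdd n)) = |(m : ℝ) - (n : ℝ)|) →
    (∀ (g : G) (k : ℤ), δ (Monoid.Coprod.inl g) (Monoid.Coprod.inr (Multiplicative.ofAdd k))
      = d g 1 + |(k : ℝ)|) →
    ∀ x y, δ x y ≤ ds x y)

/-- The Graev metric on the abstract free product `G ∗ A'` of a tsi group `(G, d)` with a copy
`A'` of its subgroup `A` (with the restricted metric). -/
def IsGraevMetricFreeProdSub {G : Type*} [Group G] (d : G → G → ℝ) (A : Subgroup G)
    (D : Monoid.Coprod G ↥A → Monoid.Coprod G ↥A → ℝ) : Prop :=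
  IsTSIMetric D ∧
  (∀ g h : G, D (Monoid.Coprod.inl g) (Monoid.Coprod.inl h) = d g h) ∧
  (∀ a a' : A, D (Monoid.Coprod.inr a) (Monoid.Coprod.inr a') = d ↑a ↑a') ∧
  (∀ (g : G) (a : A), D (Monoid.Coprod.inl g) (Monoid.Coprod.inr a) = d g 1 + d ↑a 1) ∧
  (∀ δ : Monoid.Coprod G ↥A → Monoid.Coprod G ↥A → ℝ,
    IsTSIMetric δ →
    (∀ g h : G, δ (Monoid.Coprod.inl g) (Monoid.Coprod.inl h) = d g h) →
    (∀ a a' : A, δ (Monoid.Coprod.inr a) (Monoid.Coprod.inr a') = d ↑a ↑a') →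
    (∀ (g : G) (a : A), δ (Monoid.Coprod.inl g) (Monoid.Coprod.inr a) = d g 1 + d ↑a 1) →
    ∀ x y, δ x y ≤ D x y)

/-- A length function on a group that is invariant under conjugation. -/
structure IsConjInvLength {K : Type*} [Group K] (N : K → ℝ) : Prop where
  map_one : N 1 = 0
  map_inv : ∀ x, N x⁻¹ = N x
  map_mul_le : ∀ x y, N (x * y) ≤ N x + N y
  map_conj : ∀ g x, N (g * x * g⁻¹) = N x

theorem IsConjInvLength.nonneg {K : Type*} [Group K] {N : K → ℝ} (hN : IsConjInvLength N) (x : K) :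
    0 ≤ N x := by
  have h := hN.map_mul_le x x⁻¹
  rw [mul_inv_cancel, hN.map_one, hN.map_inv] at h
  linarith

theorem IsConjInvLength.map_mul_comm {K : Type*} [Group K] {N : K → ℝ} (hN : IsConjInvLength N)
    (x y : K) : N (x * y) = N (y * x) := by
  rw [← hN.map_conj y (x * y)]
  simp [mul_assoc]

/-- `NestedCost N ι w k c` says that the word `w`, in letters from `K` and the stable letters
`true = t` and `false = t⁻¹`, can be turned into the element `k` of `K` at a cost of at most `c`.
Changing an element of `K` by `x` costs `N x`, a stable letter may be deleted at the cost `1`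
(up to moving an element of `B` across it), and a stable letter may be closed against a later
inverse one for free if the word between them has been turned into an element of `B`. -/
inductive NestedCost {K B : Type*} [Group K] [Group B] (N : K → ℝ) (ι : Bool → B →* K) :
    List (K ⊕ Bool) → K → ℝ → Prop
  | nil {k : K} {c : ℝ} : N k ≤ c → NestedCost N ι [] k c
  | base {h k : K} {w : List (K ⊕ Bool)} {c : ℝ} :
      NestedCost N ι w (h⁻¹ * k) c → NestedCost N ι (Sum.inl h :: w) k c
  | single {σ : Bool} {k : K} {w : List (K ⊕ Bool)} {c : ℝ} (b : B) :
      NestedCost N ι w ((ι (!σ) b)⁻¹ * ι σ b * k) (c - 1) → NestedCost N ι (Sum.inr σ :: w) k c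
  | pair {σ : Bool} {k : K} {w₁ w₂ : List (K ⊕ Bool)} {c c₁ : ℝ} (b : B) :
      NestedCost N ι w₁ (ι (!σ) b) c₁ → NestedCost N ι w₂ ((ι σ b)⁻¹ * k) (c - c₁) →
      NestedCost N ι (Sum.inr σ :: (w₁ ++ Sum.inr (!σ) :: w₂)) k c

theorem List.append_eq_append_cons_cases {α : Type*} {a b w₁ w₂ : List α} {s : α}
    (h : a ++ b = w₁ ++ s :: w₂) :
    (∃ z, a = w₁ ++ s :: z ∧ w₂ = z ++ b) ∨ ∃ z, w₁ = a ++ z ∧ b = z ++ s :: w₂ := by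
  rcases List.append_eq_append_iff.1 h with ⟨z, rfl, hz⟩ | ⟨z, rfl, hz⟩
  · exact Or.inr ⟨z, rfl, hz⟩
  · cases z with
    | nil => exact Or.inr ⟨[], by simp, by simpa using hz.symm⟩
    | cons x z =>
      simp only [List.cons_append, List.cons.injEq] at hz
      obtain ⟨rfl, rfl⟩ := hz
      exact Or.inl ⟨z, rfl, rfl⟩

namespace NestedCost

variable {K B : Type*} [Group K] [Group B] {N : K → ℝ} {ι : Bool → B →* K}

theorem inl_cons_iff {h k : K} {w : List (K ⊕ Bool)} {c : ℝ} :
    NestedCost N ι (Sum.inl h :: w) k c ↔ NestedCost N ι w (h⁻¹ * k) c := by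
  refine ⟨fun H => ?_, base⟩
  cases H
  assumption

theorem inl_cons_mul {k : K} {w : List (K ⊕ Bool)} {c : ℝ} (h : K) (H : NestedCost N ι w k c) :
    NestedCost N ι (Sum.inl h :: w) (h * k) c :=
  base (by rwa [inv_mul_cancel_left])

theorem inr_cons_iff {σ : Bool} {k : K} {w : List (K ⊕ Bool)} {c : ℝ} :
    NestedCost N ι (Sum.inr σ :: w) k c ↔
      (∃ b, NestedCost N ι w ((ι (!σ) b)⁻¹ * ι σ b * k) (c - 1)) ∨
      ∃ w₁ w₂ b c₁, w = w₁ ++ Sum.inr (!σ) :: w₂ ∧ NestedCost N ι w₁ (ι (!σ) b) c₁ ∧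
        NestedCost N ι w₂ ((ι σ b)⁻¹ * k) (c - c₁) := by
  constructor
  · intro H
    cases H with
    | single b h => exact Or.inl ⟨b, h⟩
    | pair b h₁ h₂ => exact Or.inr ⟨_, _, b, _, rfl, h₁, h₂⟩
  · rintro (⟨b, h⟩ | ⟨w₁, w₂, b, c₁, rfl, h₁, h₂⟩)
    · exact single b h
    · exact pair b h₁ h₂

theorem nil_iff {k : K} {c : ℝ} : NestedCost N ι [] k c ↔ N k ≤ c :=
  ⟨fun H => by cases H; assumption, nil⟩

theorem nonneg (hN : IsConjInvLength N) {w : List (K ⊕ Bool)} {k : K} {c : ℝ}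
    (H : NestedCost N ι w k c) : 0 ≤ c := by
  induction H with
  | nil h => exact (hN.nonneg _).trans h
  | base _ ih => exact ih
  | single b _ ih => linarith
  | pair b _ _ ih₁ ih₂ => linarith

theorem weaken (hN : IsConjInvLength N) {w : List (K ⊕ Bool)} {h : K} {c : ℝ}
    (H : NestedCost N ι w h c) : ∀ {k e}, N (h⁻¹ * k) + c ≤ e → NestedCost N ι w k e := by
  induction H with
  | @nil h c h₁ =>
    intro k e hke
    refine nil ?_
    have := hN.map_mul_le h (h⁻¹ * k)
    rw [mul_inv_cancel_left] at this
    linarith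
  | base _ ih =>
    intro k e hke
    refine base (ih ?_)
    convert hke using 3
    group
  | single b _ ih =>
    intro k e hke
    refine single b (ih ?_)
    rw [← add_sub_assoc]
    refine sub_le_sub_right ?_ 1
    convert hke using 3
    group
  | pair b h₁ _ _ ih₂ =>
    intro k e hke
    refine pair b h₁ (ih₂ ?_)
    rw [← add_sub_assoc]
    refine sub_le_sub_right ?_ _
    convert hke using 3
    group

theorem append (hN : IsConjInvLength N) {u v : List (K ⊕ Bool)} {h : K} {c : ℝ}
    (H : NestedCost N ι u h c) :
    ∀ {k e}, NestedCost N ι v k e → NestedCost N ι (u ++ v) (h * k) (c + e) := by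
  induction H with
  | @nil h c h₁ =>
    intro k e hke
    refine hke.weaken hN ?_
    have := hN.map_conj k⁻¹ h
    rw [inv_inv, mul_assoc] at this
    linarith
  | base _ ih =>
    intro k e hke
    refine base ?_
    rw [← mul_assoc]
    exact ih hke
  | single b _ ih =>
    intro k e hke
    rw [List.cons_append]
    refine single b ?_
    convert ih hke using 1
    · group
    · ring
  | pair b h₁ _ _ ih₂ =>
    intro k e hke
    rw [List.cons_append, List.append_assoc, List.cons_append]
    refine pair b h₁ ?_
    convert ih₂ hke using 1
    · group
    · ring

/-- A word without stable letters may be replaced, in any context, by a word that is at most as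
costly. -/
theorem replace {U : List K} {v : List (K ⊕ Bool)}
    (hUv : ∀ y k c, NestedCost N ι (U.map Sum.inl ++ y) k c → NestedCost N ι (v ++ y) k c)
    (x y : List (K ⊕ Bool)) (k : K) (c : ℝ)
    (H : NestedCost N ι (x ++ (U.map Sum.inl ++ y)) k c) :
    NestedCost N ι (x ++ (v ++ y)) k c := by
  match x, H with
  | [], H => exact hUv y k c H
  | Sum.inl h :: x, H =>
    rw [List.cons_append] at H ⊢
    exact base (replace hUv x y _ _ (inl_cons_iff.1 H))
  | Sum.inr τ :: x, H =>
    rw [List.cons_append] at H ⊢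
    rcases inr_cons_iff.1 H with ⟨b, h⟩ | ⟨w₁, w₂, b, c₁, hw, h₁, h₂⟩
    · exact single b (replace hUv x y _ _ h)
    · rcases List.append_eq_append_cons_cases hw with ⟨z, rfl, rfl⟩ | ⟨z, rfl, hz⟩
      · simpa using pair b h₁ (replace hUv z y _ _ h₂)
      · rcases List.append_eq_append_cons_cases hz with ⟨z', hz', -⟩ | ⟨z', rfl, rfl⟩
        · have : Sum.inr (!τ) ∈ U.map (Sum.inl : K → K ⊕ Bool) := by simp [hz']
          simp at this
        · simpa using pair b (replace hUv x z' _ _ h₁) h₂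
  termination_by x.length

/-- How a word whose last stable letter is followed by a single element of `K` can be priced. -/
theorem concat_cases {x : List (K ⊕ Bool)} {σ : Bool} {g h : K} {c : ℝ}
    (hN : IsConjInvLength N)
    (H : NestedCost N ι (x ++ [Sum.inr σ, Sum.inl g]) h c) :
    (∃ b, NestedCost N ι x (h * g⁻¹ * (ι (!σ) b)⁻¹ * ι σ b) (c - 1)) ∨
      ∃ x₁ x₂ b c₁, x = x₁ ++ Sum.inr (!σ) :: x₂ ∧
        NestedCost N ι x₁ (h * g⁻¹ * (ι (!σ) b)⁻¹) (c - c₁) ∧ NestedCost N ι x₂ (ι σ b) c₁ := by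
  match x, H with
  | [], H =>
    rw [List.nil_append] at H
    rcases inr_cons_iff.1 H with ⟨b, h⟩ | ⟨w₁, w₂, b, c₁, hw, h₁, h₂⟩
    · refine Or.inl ⟨b, nil ?_⟩
      rw [inl_cons_iff, nil_iff] at h
      rw [← mul_assoc, hN.map_mul_comm] at h
      simpa [mul_assoc] using h
    · have : Sum.inr (!σ) ∈ [(Sum.inl g : K ⊕ Bool)] := by simp [hw]
      simp at this
  | Sum.inl h :: x, H =>
    rw [List.cons_append, inl_cons_iff] at H
    rcases concat_cases hN H with ⟨b, h⟩ | ⟨x₁, x₂, b, c₁, rfl, h₁, h₂⟩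
    · exact Or.inl ⟨b, base (by simpa [mul_assoc] using h)⟩
    · exact Or.inr ⟨_, x₂, b, c₁, rfl, base (by simpa [mul_assoc] using h₁), h₂⟩
  | Sum.inr τ :: x, H =>
    rw [List.cons_append] at H
    rcases inr_cons_iff.1 H with ⟨b, h⟩ | ⟨w₁, w₂, b, c₁, hw, h₁, h₂⟩
    · rcases concat_cases hN h with ⟨b', h⟩ | ⟨x₁, x₂, b', c₁, rfl, h₁, h₂⟩
      · refine Or.inl ⟨b', single b ?_⟩
        convert h using 1
        group
      · refine Or.inr ⟨_, x₂, b', c₁, rfl, single b ?_, h₂⟩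
        convert h₁ using 1
        · group
        · ring
    · rcases List.append_eq_append_cons_cases hw with ⟨z, rfl, rfl⟩ | ⟨z, rfl, hz⟩
      · rcases concat_cases hN h₂ with ⟨b', h⟩ | ⟨x₁, x₂, b', c₂, rfl, h₃, h₄⟩
        · refine Or.inl ⟨b', pair b h₁ ?_⟩
          convert h using 1
          · group
          · ring
        · refine Or.inr ⟨Sum.inr τ :: (w₁ ++ Sum.inr (!τ) :: x₁), x₂, b', c₂, by simp,
            pair b h₁ ?_, h₄⟩
          convert h₃ using 1
          · group
          · ring
      · rcases z with - | ⟨s, z⟩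
        · simp only [List.nil_append, List.cons.injEq, Sum.inr.injEq] at hz
          obtain ⟨rfl, rfl⟩ := hz
          rw [inl_cons_iff, nil_iff] at h₂
          rw [Bool.not_not]
          refine Or.inr ⟨[], x, b, c₁, rfl, nil ?_, by simpa using h₁⟩
          rw [← mul_assoc, hN.map_mul_comm] at h₂
          simpa [mul_assoc] using h₂
        · have : Sum.inr (!τ) ∈ [(Sum.inl g : K ⊕ Bool)] := by
            simp only [List.cons_append, List.cons.injEq] at hz
            simp [hz.2]
          simp at this
  termination_by x.length

/-- Replacing a conjugate `t ι(a) t⁻¹` by its value in `K`, in any context, does not raise the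
cost. -/
theorem contract (hN : IsConjInvLength N) (hι : ∀ σ τ b, N (ι σ b) = N (ι τ b))
    (hι' : ∀ σ b, N (ι σ b) ≤ 1) (σ : Bool) (a : B) (x y : List (K ⊕ Bool)) (k : K) (c : ℝ)
    (H : NestedCost N ι (x ++ Sum.inr σ :: Sum.inl (ι (!σ) a) :: Sum.inr (!σ) :: y) k c) :
    NestedCost N ι (x ++ Sum.inl (ι σ a) :: y) k c := by
  match x, H with
  | [], H =>
    rw [List.nil_append] at H ⊢
    refine base ?_
    rcases inr_cons_iff.1 H with ⟨b, h⟩ | ⟨w₁, w₂, b, c₁, hw, h₁, h₂⟩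
    · rw [inl_cons_iff] at h
      rcases inr_cons_iff.1 h with ⟨b', h⟩ | ⟨w₁, w₂, b', c₁, rfl, h₁, h₂⟩
      · rw [Bool.not_not] at h
        refine h.weaken hN ?_
        have h₁ := hN.map_conj (ι σ b * k)⁻¹ (ι (!σ) (b * a * b'⁻¹) * ι σ (b' * a⁻¹ * b⁻¹))
        have h₂ := hN.map_mul_le (ι (!σ) (b * a * b'⁻¹)) (ι σ (b' * a⁻¹ * b⁻¹))
        have h₃ := hι' (!σ) (b * a * b'⁻¹)
        have h₄ := hι' σ (b' * a⁻¹ * b⁻¹)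
        simp only [map_mul, map_inv, mul_inv_rev, inv_inv, mul_assoc,
          inv_mul_cancel_left] at *
        linarith
      · rw [Bool.not_not] at h₁ ⊢
        have := append hN h₁ (single (σ := σ) (b * a * b')
          (k := (ι σ (b * a * b'))⁻¹ * ι (!σ) (b * a * b') * ((ι (!σ) b')⁻¹ *
          ((ι (!σ) a)⁻¹ * ((ι (!σ) b)⁻¹ * ι σ b * k)))) (w := w₂) (c := c - 1 - c₁ + 1)
          (by convert h₂ using 1 <;> [simp [mul_assoc]; ring]))
        convert this using 1
        · simp [mul_assoc]
        · ring
    · rcases w₁ with - | ⟨s, w₁⟩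
      · simp at hw
      simp only [List.cons_append, List.cons.injEq] at hw
      obtain ⟨rfl, hw⟩ := hw
      rw [inl_cons_iff] at h₁
      rcases w₁ with - | ⟨s, w₁⟩
      · simp only [List.nil_append, List.cons.injEq, true_and] at hw
        subst hw
        rw [nil_iff] at h₁
        refine h₂.weaken hN ?_
        have h₃ := hN.map_conj k⁻¹ (ι σ (b * a⁻¹))
        rw [hN.map_mul_comm, ← map_inv, ← map_mul, hι (!σ) σ] at h₁
        simp only [map_mul, map_inv, mul_inv_rev, inv_inv, mul_assoc] at *
        linarith
      · simp only [List.cons_append, List.cons.injEq] at hw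
        obtain ⟨rfl, rfl⟩ := hw
        rcases inr_cons_iff.1 h₁ with ⟨b', h⟩ | ⟨w₃, w₄, b', c₂, rfl, h₃, h₄⟩
        · rw [Bool.not_not] at h
          have := append hN h (single (σ := !σ) (b' * a⁻¹ * b)
            (k := (ι (!σ) (b' * a⁻¹ * b))⁻¹ * ι σ (b' * a⁻¹ * b) * ((ι σ b)⁻¹ * k)) (w := w₂)
            (c := c - c₁ + 1)
            (by convert h₂ using 1 <;> [simp [mul_assoc]; ring]))
          convert this using 1
          · simp [mul_assoc]
          · ring
        · rw [Bool.not_not] at h₃ ⊢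
          have := append hN h₃ (pair (σ := σ) (w₁ := w₄) (w₂ := w₂) (b'⁻¹ * a⁻¹ * b) (c₁ := c₁ - c₂)
            (k := (ι σ (b'⁻¹ * a⁻¹ * b)) * ((ι σ b)⁻¹ * k)) (c := c - c₂)
            (by convert h₄ using 1; simp [mul_assoc])
            (by convert h₂ using 1 <;> [simp [mul_assoc]; ring]))
          convert this using 1
          · simp
          · simp [mul_assoc]
          · ring
  | Sum.inl h :: x, H =>
    rw [List.cons_append] at H ⊢
    exact base (contract hN hι hι' σ a x y _ _ (inl_cons_iff.1 H))
  | Sum.inr τ :: x, H =>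
    rw [List.cons_append] at H ⊢
    rcases inr_cons_iff.1 H with ⟨b, h⟩ | ⟨w₁, w₂, b, c₁, hw, h₁, h₂⟩
    · exact single b (contract hN hι hι' σ a x y _ _ h)
    rcases List.append_eq_append_cons_cases hw with ⟨z, rfl, rfl⟩ | ⟨z, rfl, hz⟩
    · simpa using pair b h₁ (contract hN hι hι' σ a z y _ _ h₂)
    rcases z with - | ⟨s, z⟩
    · simp only [List.nil_append, List.cons.injEq, Sum.inr.injEq] at hz
      obtain ⟨rfl, rfl⟩ := hz
      rw [List.append_nil] at h₁
      rw [inl_cons_iff] at h₂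
      simp only [Bool.not_not] at *
      rcases inr_cons_iff.1 h₂ with ⟨b', h⟩ | ⟨w₃, w₄, b', c₂, rfl, h₃, h₄⟩
      · refine single (b' * a⁻¹ * b⁻¹) ?_
        have := append hN h₁ (inl_cons_mul (ι (!τ) a) h)
        convert this using 1
        · simp [mul_assoc]
        · ring
      · have := append hN h₁ (inl_cons_mul (ι (!τ) a) h₃)
        rw [← map_mul, ← map_mul, ← mul_assoc] at this
        have := pair (σ := τ) (w₂ := w₄) (k := k) (c := c) (b * a * b') this
          (by convert h₄ using 1 <;> [simp [mul_assoc]; ring])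
        simpa using this
    simp only [List.cons_append, List.cons.injEq] at hz
    obtain ⟨rfl, hz⟩ := hz
    rcases z with - | ⟨s, z⟩
    · simp at hz
    simp only [List.cons_append, List.cons.injEq] at hz
    obtain ⟨rfl, hz⟩ := hz
    rcases z with - | ⟨s, z⟩
    · simp only [List.nil_append, List.cons.injEq, Sum.inr.injEq, Bool.not_inj_iff] at hz
      obtain ⟨rfl, rfl⟩ := hz
      rcases concat_cases hN h₁ with ⟨b', h⟩ | ⟨x₁, x₂, b', c₂, rfl, h₃, h₄⟩
      · refine single (b' * a * b⁻¹) ?_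
        have := append hN h (inl_cons_mul (ι σ a) h₂)
        convert this using 1
        · simp [mul_assoc]
        · ring
      · have := append hN h₄ (inl_cons_mul (ι σ a) h₂)
        have := pair (σ := σ) (k := k) (c := c) (b * a⁻¹ * b'⁻¹) (c₁ := c₁ - c₂)
          (by convert h₃ using 1; simp [mul_assoc])
          (by convert this using 1 <;> [simp [mul_assoc]; ring])
        simpa using this
    · simp only [List.cons_append, List.cons.injEq] at hz
      obtain ⟨rfl, rfl⟩ := hz
      simpa using pair b (contract hN hι hι' σ a x z _ _ h₁) h₂
  termination_by x.length

theorem exists_cost (w : List (K ⊕ Bool)) (k : K) : ∃ c, NestedCost N ι w k c := by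
  induction w generalizing k with
  | nil => exact ⟨_, nil le_rfl⟩
  | cons s w ih =>
    rcases s with h | σ
    · exact (ih _).imp fun c => base
    · obtain ⟨c, hc⟩ := ih ((ι (!σ) 1)⁻¹ * ι σ 1 * k)
      exact ⟨c + 1, single 1 (by rwa [add_sub_cancel_right])⟩

variable (N ι) in
/-- The syntactic congruence of `NestedCost`: two words are related if they have the same costs in
every context. -/
def contextCon : Con (FreeMonoid (K ⊕ Bool)) where
  r u v := ∀ (x y : List (K ⊕ Bool)) (k : K) (c : ℝ),
    NestedCost N ι (x ++ (u.toList ++ y)) k c ↔ NestedCost N ι (x ++ (v.toList ++ y)) k c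
  iseqv := ⟨fun _ _ _ _ _ => Iff.rfl, fun h x y k c => (h x y k c).symm,
    fun h h' x y k c => (h x y k c).trans (h' x y k c)⟩
  mul' {u v u' v'} h h' x y k c := by
    have h₁ := h x (u'.toList ++ y) k c
    have h₂ := h' (x ++ v.toList) y k c
    simp only [FreeMonoid.toList_mul, List.append_assoc] at *
    exact h₁.trans h₂

theorem contextCon_of_prod_eq {U V : List K} (h : U.prod = V.prod) :
    contextCon N ι (FreeMonoid.ofList (U.map Sum.inl)) (FreeMonoid.ofList (V.map Sum.inl)) := by
  have key : ∀ (U : List K) (y : List (K ⊕ Bool)) (k : K) (c : ℝ),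
      NestedCost N ι (U.map Sum.inl ++ y) k c ↔ NestedCost N ι y (U.prod⁻¹ * k) c := by
    intro U y
    induction U with
    | nil => simp
    | cons g U ih => intro k c; simp [inl_cons_iff, ih, mul_assoc]
  intro x y k c
  constructor
  · exact replace (fun y k c => by simp only [FreeMonoid.toList_ofList, key, h, imp_self]) x y k c
  · exact replace (fun y k c => by simp only [FreeMonoid.toList_ofList, key, h, imp_self]) x y k c

theorem contextCon_conj (hN : IsConjInvLength N) (hι : ∀ σ τ b, N (ι σ b) = N (ι τ b))
    (hι' : ∀ σ b, N (ι σ b) ≤ 1) (σ : Bool) (a : B) :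
    contextCon N ι (FreeMonoid.of (Sum.inr σ) * FreeMonoid.of (Sum.inl (ι (!σ) a)) *
      FreeMonoid.of (Sum.inr (!σ))) (FreeMonoid.of (Sum.inl (ι σ a))) := by
  intro x y k c
  constructor
  · intro H
    exact contract hN hι hι' σ a x y k c H
  · refine replace (U := [ι σ a]) (fun y k c H => ?_) x y k c
    rw [List.map_singleton, List.singleton_append, inl_cons_iff] at H
    exact pair (w₁ := [Sum.inl (ι (!σ) a)]) (c₁ := 0) a (base (nil (by simp [hN.map_one])))
      (by simpa using H)

variable (N ι) in
/-- The group elements of `K`, as classes of one-letter words. -/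
def letterHom : K →* (contextCon N ι).Quotient where
  toFun k := (FreeMonoid.of (Sum.inl k) : FreeMonoid (K ⊕ Bool))
  map_one' := (Con.eq _).2 (contextCon_of_prod_eq (U := [1]) (V := []) (by simp))
  map_mul' g h := (Con.eq _).2 (contextCon_of_prod_eq (U := [g * h]) (V := [g, h]) (by simp))

theorem letter_conj (hN : IsConjInvLength N) (hι : ∀ σ τ b, N (ι σ b) = N (ι τ b))
    (hι' : ∀ σ b, N (ι σ b) ≤ 1) (σ : Bool) (a : B) :
    ((FreeMonoid.of (Sum.inr σ) : FreeMonoid (K ⊕ Bool)) : (contextCon N ι).Quotient) *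
      letterHom N ι (ι (!σ) a) *
      ((FreeMonoid.of (Sum.inr (!σ)) : FreeMonoid (K ⊕ Bool)) : (contextCon N ι).Quotient) =
      letterHom N ι (ι σ a) :=
  (Con.eq _).2 (contextCon_conj hN hι hι' σ a)

/-- The class of the stable letter `t`. -/
def letterUnit (hN : IsConjInvLength N) (hι : ∀ σ τ b, N (ι σ b) = N (ι τ b))
    (hι' : ∀ σ b, N (ι σ b) ≤ 1) : (contextCon N ι).Quotientˣ where
  val := (FreeMonoid.of (Sum.inr true) : FreeMonoid (K ⊕ Bool))
  inv := (FreeMonoid.of (Sum.inr false) : FreeMonoid (K ⊕ Bool))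
  val_inv := by simpa using letter_conj hN hι hι' true 1
  inv_val := by simpa using letter_conj hN hι hι' false 1

variable {H : Type*} [Group H]

/-- Evaluation of words in a group that contains `K` and a stable letter. -/
def evalHom (ψ : K →* H) (t : H) : FreeMonoid (K ⊕ Bool) →* H :=
  FreeMonoid.lift (Sum.elim ψ fun σ => cond σ t t⁻¹)

/-- If `H` is generated by `K` and `t`, subject only to the relations that are respected by
`NestedCost`, then the length function of `K` extends to `H` with `t` of length at most one. -/
theorem exists_extension (hN : IsConjInvLength N) (hι : ∀ σ τ b, N (ι σ b) = N (ι τ b))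
    (hι' : ∀ σ b, N (ι σ b) ≤ 1) (ψ : K →* H) (t : H)
    (hsurj : Function.Surjective (evalHom ψ t))
    (Φ : H →* (contextCon N ι).Quotient) (hΦψ : ∀ k, Φ (ψ k) = letterHom N ι k)
    (hΦt : Φ t = letterUnit hN hι hι') :
    ∃ L : H → ℝ, IsConjInvLength L ∧ (∀ k, L (ψ k) = N k) ∧ L t ≤ 1 := by
  have hΦt' : Φ t⁻¹ = ((letterUnit hN hι hι')⁻¹ : (contextCon N ι).Quotientˣ) := by
    rw [← Units.mul_eq_one_iff_eq_inv, ← hΦt, ← map_mul, inv_mul_cancel, map_one]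
  have hΦ : ∀ w, Φ (evalHom ψ t w) = (w : (contextCon N ι).Quotient) := by
    intro w
    suffices Φ.comp (evalHom ψ t) = (contextCon N ι).mk' from DFunLike.congr_fun this w
    refine FreeMonoid.hom_eq fun s => ?_
    rcases s with k | σ
    · refine Eq.trans ?_ (hΦψ k)
      simp [evalHom]
    · cases σ
      · refine Eq.trans ?_ hΦt'
        simp [evalHom]
      · refine Eq.trans ?_ hΦt
        simp [evalHom]
  let S : H → Set ℝ := fun x => {c | ∃ w, evalHom ψ t w = x ∧ NestedCost N ι w.toList 1 c}
  have hbdd : ∀ x, BddBelow (S x) := fun x => ⟨0, by rintro c ⟨w, -, hw⟩; exact hw.nonneg hN⟩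
  have hne : ∀ x, (S x).Nonempty := by
    intro x
    obtain ⟨w, rfl⟩ := hsurj x
    obtain ⟨c, hc⟩ := exists_cost (N := N) (ι := ι) w.toList 1
    exact ⟨c, w, rfl, hc⟩
  let ℓ : H → ℝ := fun x => sInf (S x)
  have hle : ∀ {x c}, c ∈ S x → ℓ x ≤ c := fun h => csInf_le (hbdd _) h
  have hnonneg : ∀ x, 0 ≤ ℓ x := fun x =>
    le_csInf (hne x) (by rintro c ⟨w, -, hw⟩; exact hw.nonneg hN)
  have hone : ℓ 1 ≤ 0 := hle ⟨1, map_one _, nil hN.map_one.le⟩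
  have hmul : ∀ x y, ℓ (x * y) ≤ ℓ x + ℓ y := by
    intro x y
    rw [← sub_le_iff_le_add]
    refine le_csInf (hne x) ?_
    rintro c ⟨u, rfl, hu⟩
    rw [sub_le_comm]
    refine le_csInf (hne y) ?_
    rintro e ⟨v, rfl, hv⟩
    rw [sub_le_iff_le_add']
    exact hle ⟨u * v, map_mul _ _ _, by simpa using append hN hu hv⟩
  have hconj : ∀ y x, ℓ (y * x * y⁻¹) ≤ ℓ x := by
    intro y
    obtain ⟨v, rfl⟩ := hsurj y
    induction v with
    | one => simp
    | of s =>
      intro x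
      refine le_csInf (hne x) ?_
      rintro c ⟨u, rfl, hu⟩
      rcases s with k | σ
      · refine hle ⟨FreeMonoid.of (Sum.inl k) * u * FreeMonoid.of (Sum.inl k⁻¹), ?_, ?_⟩
        · simp [evalHom]
        · have := append hN (inl_cons_mul k hu)
            (inl_cons_mul k⁻¹ (nil (N := N) (ι := ι) hN.map_one.le))
          simpa using this
      · refine hle ⟨FreeMonoid.of (Sum.inr σ) * u * FreeMonoid.of (Sum.inr (!σ)), ?_, ?_⟩
        · cases σ <;> simp [evalHom]
        · have := pair (σ := σ) (k := 1) (w₁ := u.toList) (w₂ := []) (N := N) (ι := ι) (c := c) 1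
            (by simpa using hu) (nil (by simp [hN.map_one]))
          simpa using this
    | mul u v hu hv =>
      intro x
      have := (hu _).trans (hv x)
      simpa [mul_assoc] using this
  have hψ : ∀ k, ℓ (ψ k) = N k := by
    intro k
    refine le_antisymm (hle ⟨FreeMonoid.of (Sum.inl k), by simp [evalHom], base (nil ?_)⟩) ?_
    · simp [hN.map_inv]
    · refine le_csInf (hne _) ?_
      rintro c ⟨w, hw, hc⟩
      have h₁ : (w : (contextCon N ι).Quotient) =
          ((FreeMonoid.of (Sum.inl k) : FreeMonoid (K ⊕ Bool)) : (contextCon N ι).Quotient) := by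
        rw [← hΦ w, hw, hΦψ]
        rfl
      have h₂ := ((Con.eq _).1 h₁ [] [] 1 c).1 (by simpa using hc)
      have h₃ := nil_iff.1 (inl_cons_iff.1 h₂)
      simpa [hN.map_inv] using h₃
  have ht : ℓ t ≤ 1 := hle ⟨FreeMonoid.of (Sum.inr true), by simp [evalHom],
    single 1 (nil (by simp [hN.map_one]))⟩
  have ht' : ℓ t⁻¹ ≤ 1 := hle ⟨FreeMonoid.of (Sum.inr false), by simp [evalHom],
    single 1 (nil (by simp [hN.map_one]))⟩
  have hconj_eq : ∀ y x, ℓ (y * x * y⁻¹) = ℓ x := fun y x =>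
    (hconj y x).antisymm (by simpa [mul_assoc] using hconj y⁻¹ (y * x * y⁻¹))
  refine ⟨fun x => max (ℓ x) (ℓ x⁻¹), ⟨?_, ?_, ?_, ?_⟩, ?_, max_le ht ht'⟩
  · simpa using le_antisymm hone (hnonneg 1)
  · intro x
    rw [inv_inv, max_comm]
  · intro x y
    refine max_le ((hmul x y).trans (add_le_add (le_max_left _ _) (le_max_left _ _))) ?_
    rw [mul_inv_rev, add_comm]
    exact (hmul _ _).trans (add_le_add (le_max_right _ _) (le_max_right _ _))
  · intro y x
    have := hconj_eq y x⁻¹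
    simp only [mul_inv_rev, inv_inv, ← mul_assoc] at this ⊢
    rw [hconj_eq, this]
  · intro k
    simp only [← map_inv, hψ, hN.map_inv, max_self]

end NestedCost

namespace IsTSIMetric

variable {H : Type*} [Group H] {d : H → H → ℝ}

theorem eq_inv_mul (hd : IsTSIMetric d) (x y : H) : d x y = d (x⁻¹ * y) 1 := by
  rw [hd.2.1 _ 1, ← hd.2.2.2.1 x⁻¹ x y, inv_mul_cancel]

theorem isConjInvLength (hd : IsTSIMetric d) : IsConjInvLength fun x => d x 1 where
  map_one := (hd.1 1 1).2 rfl
  map_inv x := by rw [hd.2.1, ← hd.2.2.2.1 x, mul_one, mul_inv_cancel]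
  map_mul_le x y := by
    have := hd.2.2.1 (x * y) x 1
    have h := hd.2.2.2.1 x y 1
    rw [mul_one] at h
    linarith
  map_conj g x := by
    rw [← hd.2.2.2.2 g, ← hd.2.2.2.1 g⁻¹]
    simp [mul_assoc]

theorem max_length (hd : IsTSIMetric d) {L : H → ℝ} (hL : IsConjInvLength L) :
    IsTSIMetric fun x y => max (d x y) (L (x⁻¹ * y)) := by
  refine ⟨fun x y => ⟨fun h => ?_, ?_⟩, fun x y => ?_, fun x y z => ?_, fun g x y => ?_,
    fun g x y => ?_⟩
  · refine (hd.1 x y).1 (le_antisymm (h ▸ le_max_left _ _) ?_)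
    rw [hd.eq_inv_mul]
    exact hd.isConjInvLength.nonneg _
  · rintro rfl
    simp [(hd.1 x x).2 rfl, hL.map_one]
  · have := hL.map_inv (x⁻¹ * y)
    rw [mul_inv_rev, inv_inv] at this
    simp only [hd.2.1 x y, this]
  · refine max_le ((hd.2.2.1 x y z).trans (add_le_add (le_max_left _ _) (le_max_left _ _))) ?_
    have := hL.map_mul_le (x⁻¹ * y) (y⁻¹ * z)
    simp only [mul_assoc, mul_inv_cancel_left] at this
    exact this.trans (add_le_add (le_max_right _ _) (le_max_right _ _))
  · simp [hd.2.2.2.1, mul_assoc]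
  · have := hL.map_conj g⁻¹ (x⁻¹ * y)
    simp only [mul_inv_rev, inv_inv, mul_assoc] at this ⊢
    rw [hd.2.2.2.2, this]

end IsTSIMetric

theorem IsConjInvLength.comp {K H : Type*} [Group K] [Group H] {N : H → ℝ}
    (hN : IsConjInvLength N) (f : K →* H) : IsConjInvLength fun x => N (f x) where
  map_one := by simp [hN.map_one]
  map_inv x := by simp [hN.map_inv]
  map_mul_le x y := by simpa using hN.map_mul_le (f x) (f y)
  map_conj g x := by simpa using hN.map_conj (f g) (f x)

theorem IsConjInvLength.zpow_le {H : Type*} [Group H] {L : H → ℝ} (hL : IsConjInvLength L) {t : H}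
    (ht : L t ≤ 1) (n : ℤ) : L (t ^ n) ≤ |(n : ℝ)| := by
  have key : ∀ m : ℕ, L (t ^ m) ≤ m := by
    intro m
    induction m with
    | zero => simp [hL.map_one]
    | succ m ih =>
      rw [pow_succ]
      push_cast
      linarith [hL.map_mul_le (t ^ m) t]
  rcases n.eq_nat_or_neg with ⟨m, rfl | rfl⟩
  · simpa using key m
  · simpa [hL.map_inv] using key m

section Graev

open Monoid

variable {G : Type*} [Group G] {d : G → G → ℝ}

theorem IsGraevMetricFreeProdZ.length_le
    {ds : Coprod G (Multiplicative ℤ) → Coprod G (Multiplicative ℤ) → ℝ}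
    (hd : IsTSIMetric d) (hds : IsGraevMetricFreeProdZ d ds)
    {L : Coprod G (Multiplicative ℤ) → ℝ} (hL : IsConjInvLength L)
    (hG : ∀ g : G, L (Coprod.inl g) ≤ d g 1)
    (ht : L (Coprod.inr (Multiplicative.ofAdd 1)) ≤ 1) (x y : Coprod G (Multiplicative ℤ)) :
    L (x⁻¹ * y) ≤ ds x y := by
  have hZ : ∀ n : ℤ, L (Coprod.inr (Multiplicative.ofAdd n)) ≤ |(n : ℝ)| := by
    intro n
    have := hL.zpow_le ht n
    rwa [← map_zpow, ← ofAdd_zsmul, smul_eq_mul, mul_one] at this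
  obtain ⟨htsi, h₁, h₂, h₃, hmax⟩ := hds
  refine (le_max_right _ _).trans (hmax _ (htsi.max_length hL) ?_ ?_ ?_ x y)
  · intro g h
    rw [h₁, max_eq_left]
    rw [hd.eq_inv_mul g h, ← map_inv, ← map_mul]
    exact hG _
  · intro m n
    rw [h₂, max_eq_left]
    rw [← map_inv, ← map_mul, ← ofAdd_neg, ← ofAdd_add]
    refine (hZ _).trans_eq ?_
    rw [abs_sub_comm]
    push_cast
    ring_nf
  · intro g n
    rw [h₃, max_eq_left]
    have := hL.map_mul_le (Coprod.inl g)⁻¹ (Coprod.inr (Multiplicative.ofAdd n))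
    rw [hL.map_inv] at this
    linarith [hG g, hZ n]

theorem IsGraevMetricFreeProdSub.length_le {A : Subgroup G} {D : Coprod G A → Coprod G A → ℝ}
    (hd : IsTSIMetric d) (hD : IsGraevMetricFreeProdSub d A D)
    {L : Coprod G A → ℝ} (hL : IsConjInvLength L)
    (hG : ∀ g : G, L (Coprod.inl g) ≤ d g 1)
    (hA : ∀ a : A, L (Coprod.inr a) ≤ d a 1) (x y : Coprod G A) :
    L (x⁻¹ * y) ≤ D x y := by
  obtain ⟨htsi, h₁, h₂, h₃, hmax⟩ := hD
  refine (le_max_right _ _).trans (hmax _ (htsi.max_length hL) ?_ ?_ ?_ x y)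
  · intro g h
    rw [h₁, max_eq_left]
    rw [hd.eq_inv_mul g h, ← map_inv, ← map_mul]
    exact hG _
  · intro a b
    rw [h₂, max_eq_left]
    rw [hd.eq_inv_mul a b, ← map_inv, ← map_mul]
    exact hA _
  · intro g a
    rw [h₃, max_eq_left]
    have := hL.map_mul_le (Coprod.inl g)⁻¹ (Coprod.inr a)
    rw [hL.map_inv] at this
    linarith [hG g, hA a]

/-- The length function of a Graev metric on `G ∗ A'`, with `diam A ≤ 1`, extends to `G ∗ ⟨t⟩` with
`t` of length at most one. -/
theorem IsGraevMetricFreeProdSub.exists_length {A : Subgroup G} {D : Coprod G A → Coprod G A → ℝ}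
    (hD : IsGraevMetricFreeProdSub d A D)
    (ψ : Coprod G A →* Coprod G (Multiplicative ℤ))
    (hψl : ∀ g : G, ψ (Coprod.inl g) = Coprod.inl g)
    (hψr : ∀ a : A, ψ (Coprod.inr a) = Coprod.inr (Multiplicative.ofAdd (1 : ℤ)) *
      Coprod.inl (↑a : G) * (Coprod.inr (Multiplicative.ofAdd (1 : ℤ)))⁻¹)
    (hA : ∀ a : A, d a 1 ≤ 1) :
    ∃ L : Coprod G (Multiplicative ℤ) → ℝ, IsConjInvLength L ∧ (∀ k, L (ψ k) = D k 1) ∧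
      L (Coprod.inr (Multiplicative.ofAdd (1 : ℤ))) ≤ 1 := by
  let ι : Bool → A →* Coprod G A := fun σ => cond σ Coprod.inr (Coprod.inl.comp A.subtype)
  have hN := hD.1.isConjInvLength
  have hι : ∀ σ b, D (ι σ b) 1 = d b 1 := by
    intro σ b
    cases σ
    · simpa [ι] using hD.2.1 b 1
    · simpa [ι] using hD.2.2.1 b 1
  have hι₁ : ∀ σ τ b, D (ι σ b) 1 = D (ι τ b) 1 := fun σ τ b => by rw [hι, hι]
  have hι₂ : ∀ σ b, D (ι σ b) 1 ≤ 1 := fun σ b => (hι σ b).trans_le (hA b)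
  let u := NestedCost.letterUnit hN hι₁ hι₂
  let Φ : Coprod G (Multiplicative ℤ) →* (NestedCost.contextCon (fun x => D x 1) ι).Quotient :=
    Coprod.lift ((NestedCost.letterHom _ ι).comp Coprod.inl)
      ((Units.coeHom _).comp (zpowersHom _ u))
  have hΦt : Φ (Coprod.inr (Multiplicative.ofAdd (1 : ℤ))) = u := by simp [Φ]
  have hΦt' : Φ (Coprod.inr (Multiplicative.ofAdd (1 : ℤ)))⁻¹ = (u⁻¹ : Units _) := by
    rw [← Units.mul_eq_one_iff_eq_inv, ← hΦt, ← map_mul, inv_mul_cancel, map_one]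
  refine NestedCost.exists_extension hN hι₁ hι₂ ψ _ ?_ Φ ?_ hΦt
  · rw [← MonoidHom.mrange_eq_top, eq_top_iff]
    rintro x -
    induction x using Coprod.induction_on with
    | inl g => exact ⟨FreeMonoid.of (Sum.inl (Coprod.inl g)), by simp [NestedCost.evalHom, hψl]⟩
    | inr n =>
      obtain ⟨m, hm | hm⟩ := (Multiplicative.toAdd n).eq_nat_or_neg
      · refine ⟨FreeMonoid.of (Sum.inr true) ^ m, ?_⟩
        rw [← ofAdd_toAdd n, hm, map_pow]
        simp [NestedCost.evalHom, ← map_pow, ← ofAdd_nsmul]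
      · refine ⟨FreeMonoid.of (Sum.inr false) ^ m, ?_⟩
        rw [← ofAdd_toAdd n, hm, map_pow]
        simp [NestedCost.evalHom, ← map_inv, ← map_pow, ← ofAdd_nsmul]
    | mul x y hx hy => exact mul_mem hx hy
  · intro k
    suffices Φ.comp ψ = NestedCost.letterHom _ ι from DFunLike.congr_fun this k
    refine Coprod.hom_ext (MonoidHom.ext fun g => ?_) (MonoidHom.ext fun a => ?_)
    · simp [hψl, Φ]
    · rw [MonoidHom.comp_apply, MonoidHom.comp_apply, hψr, map_mul, map_mul, hΦt, hΦt']
      have := NestedCost.letter_conj hN hι₁ hι₂ true a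
      refine Eq.trans ?_ this
      simp [Φ, ι, u, NestedCost.letterUnit]

end Graev

/-- **The induced metric on `G ∗ tAt⁻¹`.**  The canonical injection of the abstract free product
`G ∗ A'` into `G ∗ ⟨t⟩` sending `g ↦ g` and `a ↦ t a t⁻¹` is an isometry between the Graev
metric on `G ∗ A'` and the metric induced from the Graev metric on `G ∗ ⟨t⟩` if and only if the
diameter of `A` is at most `1`. -/
theorem graev_free_prod_conj_isometry_iff_diam_le_one {G : Type*} [Group G]
    (d : G → G → ℝ) (hd : IsTSIMetric d) (A : Subgroup G) (hA : IsDClosed d (A : Set G))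
    (ds : Monoid.Coprod G (Multiplicative ℤ) → Monoid.Coprod G (Multiplicative ℤ) → ℝ)
    (hds : IsGraevMetricFreeProdZ d ds)
    (D : Monoid.Coprod G ↥A → Monoid.Coprod G ↥A → ℝ)
    (hD : IsGraevMetricFreeProdSub d A D)
    (ψ : Monoid.Coprod G ↥A →* Monoid.Coprod G (Multiplicative ℤ))
    (hψl : ∀ g : G, ψ (Monoid.Coprod.inl g) = Monoid.Coprod.inl g)
    (hψr : ∀ a : A, ψ (Monoid.Coprod.inr a)
      = Monoid.Coprod.inr (Multiplicative.ofAdd (1 : ℤ)) * Monoid.Coprod.inl (↑a : G) *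
        (Monoid.Coprod.inr (Multiplicative.ofAdd (1 : ℤ)))⁻¹)
    (hψinj : Function.Injective ψ) :
    (∀ x y : Monoid.Coprod G ↥A, D x y = ds (ψ x) (ψ y)) ↔ (∀ a a' : A, d ↑a ↑a' ≤ 1) := by
  constructor
  · intro h a a'
    have key : ∀ a : A, d a 1 ≤ 1 := by
      intro a
      have hN := hds.1.isConjInvLength
      set t := Monoid.Coprod.inr (M := G) (Multiplicative.ofAdd (1 : ℤ)) with ht
      have ht₁ : ds t 1 = 1 := by
        have := hds.2.2.1 1 0
        rwa [← ht, ofAdd_zero, map_one Monoid.Coprod.inr, Int.cast_one, Int.cast_zero,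
          sub_zero, abs_one] at this
      have h₁ := h (Monoid.Coprod.inl ↑a) (Monoid.Coprod.inr a)
      rw [hD.2.2.2.1, hψl, hψr, hds.1.eq_inv_mul, ← mul_assoc, ← mul_assoc] at h₁
      set g := Monoid.Coprod.inl (N := Multiplicative ℤ) (a : G)
      have h₂ := hN.map_mul_le (g⁻¹ * t * g) t⁻¹
      have h₃ := hN.map_conj g⁻¹ t
      have h₄ := hN.map_inv t
      rw [inv_inv] at h₃
      linarith
    have h₁ := key (a⁻¹ * a')
    rw [hd.eq_inv_mul]
    simpa using h₁
  · intro h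
    obtain ⟨L, hL, hLψ, hLt⟩ := hD.exists_length ψ hψl hψr fun a => by simpa using h a 1
    intro x y
    refine le_antisymm ?_ ?_
    · have := hds.length_le hd hL (fun g => ?_) hLt (ψ x) (ψ y)
      · rwa [← map_inv, ← map_mul, hLψ, ← hD.1.eq_inv_mul] at this
      · rw [← hψl, hLψ, ← map_one Monoid.Coprod.inl, hD.2.1]
    · have := hD.length_le hd (hds.1.isConjInvLength.comp ψ) (fun g => ?_) (fun a => ?_) x y
      · rwa [map_mul, map_inv, ← hds.1.eq_inv_mul] at this
      · rw [hψl, ← map_one Monoid.Coprod.inl, hds.2.1]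
      · rw [hψr, hds.1.isConjInvLength.map_conj, ← map_one Monoid.Coprod.inl, hds.2.1]
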